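/- arXiv:1509.04346 — 3 statements merged into one kernel-verified Lean document; each statement's English description precedes it below -/
import Mathlib

section
/- Let M be an ultrametric space and X a topologically dense subset of M. Then the subspace M↾X satisfies property h1 (respectively property h2) if and only if M does. Moreover, when property h (the conjunction of h1 and h2) is satisfied, M↾X and M have the same degree sequence: s_{M↾X}(r) = s_M(r) for every r in the common spectrum minus {0}. -/
open Metric

section Defs

variable (M : Type*) [MetricSpace M]

/-- The spectrum of a point `a`: the set of distances from `a` to points of the space. -/
def specAt (a : M) : Set ℝ := Set.range (dist a)

/-- The spectrum of the whole space. -/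
def specSet : Set ℝ := {r | ∃ x y : M, dist x y = r}

/-- The nerve of `M`: closed balls `B̂(a, r)` with `a ∈ M` and `r ∈ Spec(M, a)`. -/
def nerv : Set (Set M) := {B | ∃ (a : M) (r : ℝ), r ∈ specAt M a ∧ B = closedBall a r}

/-- The sons of a set `B`: the open balls of radius `δ(B)` contained in `B`. -/
def sons (B : Set M) : Set (Set M) :=
  {S | (∃ a : M, S = ball a (Metric.diam B)) ∧ S ⊆ B}

/-- Property `h1`: all points have the same spectrum. -/
def PropH1 : Prop := ∀ x x' : M, specAt M x = specAt M x'

/-- Property `h2`: any two members of the nerve having the same diameter have the same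
number of sons. -/
def PropH2 : Prop :=
  ∀ B ∈ nerv M, ∀ B' ∈ nerv M, Metric.diam B = Metric.diam B' →
    Cardinal.mk (sons M B) = Cardinal.mk (sons M B')

/-- The degree sequence: `s_M(r)` is the supremum of the number of sons of members
of the nerve of diameter `r`. -/
noncomputable def degSeq (r : ℝ) : Cardinal :=
  sSup {c | ∃ B ∈ nerv M, Metric.diam B = r ∧ c = Cardinal.mk (sons M B)}

end Defs

section Ultrametric

variable {M : Type*} [MetricSpace M]

lemma zero_mem_specAt (a : M) : (0 : ℝ) ∈ specAt M a := ⟨a, dist_self a⟩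

lemma specAt_eq_of_forall_pos {a b : M} (h : ∀ r > 0, r ∈ specAt M a ↔ r ∈ specAt M b) :
    specAt M a = specAt M b := by
  ext r
  rcases lt_trichotomy r 0 with hr | rfl | hr
  · constructor <;> rintro ⟨x, rfl⟩ <;> exact absurd hr (not_lt.mpr dist_nonneg)
  · simp only [zero_mem_specAt]
  · exact h r hr

/-- Only the empty set is a son of a member of the nerve of diameter zero. -/
lemma mk_sons_of_diam_eq_zero {B : Set M} (hB : B ∈ nerv M) (h : diam B = 0) :
    Cardinal.mk (sons M B) = 1 := by
  obtain ⟨a, -⟩ := hB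
  have : sons M B = {∅} := by
    ext S
    simp only [sons, h, ball_zero, Set.mem_ofPred_eq, Set.mem_singleton_iff]
    exact ⟨fun hS => hS.1.choose_spec, fun hS => ⟨⟨a, hS⟩, hS ▸ Set.empty_subset _⟩⟩
  rw [this, Cardinal.mk_singleton]

variable [IsUltrametricDist M]

lemma dist_eq_of_dist_lt_of_dist_eq {a b x : M} {r : ℝ} (hab : dist a b < r)
    (hax : dist a x = r) : dist b x = r := by
  apply le_antisymm
  · exact (dist_triangle_max b a x).trans (max_le (dist_comm a b ▸ hab.le) hax.le)
  · rcases le_max_iff.mp (dist_triangle_max a b x) with h | h <;> linarith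

lemma mem_specAt_of_dist_lt {a b : M} {r : ℝ} (hab : dist a b < r) (ha : r ∈ specAt M a) :
    r ∈ specAt M b := by
  obtain ⟨x, hx⟩ := ha
  exact ⟨x, dist_eq_of_dist_lt_of_dist_eq hab hx⟩

lemma diam_closedBall_of_mem_specAt {a : M} {r : ℝ} (h : r ∈ specAt M a) :
    diam (closedBall a r) = r := by
  obtain ⟨x, rfl⟩ := h
  apply le_antisymm
  · refine diam_le_of_forall_dist_le dist_nonneg fun y hy z hz => ?_
    rw [mem_closedBall] at hy hz
    exact (dist_triangle_max y a z).trans (max_le hy (dist_comm z a ▸ hz))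
  · exact dist_le_diam_of_mem isBounded_closedBall (mem_closedBall_self dist_nonneg)
      (by rw [mem_closedBall, dist_comm])

lemma exists_eq_closedBall_diam {B : Set M} (hB : B ∈ nerv M) :
    ∃ a, diam B ∈ specAt M a ∧ B = closedBall a (diam B) := by
  obtain ⟨a, r, hr, rfl⟩ := hB
  rw [diam_closedBall_of_mem_specAt hr]
  exact ⟨a, hr, rfl⟩

variable {X : Set M}

lemma specAt_subtype (hX : Dense X) (a : X) : specAt X a = specAt M a := by
  ext r
  constructor
  · rintro ⟨x, rfl⟩
    exact ⟨x, rfl⟩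
  · rintro ⟨x, rfl⟩
    rcases (dist_nonneg : 0 ≤ dist (a : M) x).eq_or_lt with h | h
    · exact h ▸ zero_mem_specAt a
    · obtain ⟨y, hyX, hy⟩ := hX.exists_dist_lt x h
      refine ⟨⟨y, hyX⟩, ?_⟩
      rw [Subtype.dist_eq, dist_comm]
      exact dist_eq_of_dist_lt_of_dist_eq hy (dist_comm x a)

lemma propH1_subtype_iff (hX : Dense X) : PropH1 X ↔ PropH1 M := by
  constructor
  · intro h a b
    apply specAt_eq_of_forall_pos
    intro r hr
    obtain ⟨a', ha', haa'⟩ := hX.exists_dist_lt a hr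
    obtain ⟨b', hb', hbb'⟩ := hX.exists_dist_lt b hr
    have hab : specAt M a' = specAt M b' := by
      simpa only [specAt_subtype hX] using h ⟨a', ha'⟩ ⟨b', hb'⟩
    exact ⟨fun hra => mem_specAt_of_dist_lt (dist_comm b b' ▸ hbb')
        (hab ▸ mem_specAt_of_dist_lt haa' hra),
      fun hrb => mem_specAt_of_dist_lt (dist_comm a a' ▸ haa')
        (hab ▸ mem_specAt_of_dist_lt hbb' hrb)⟩
  · intro h a b
    rw [specAt_subtype hX, specAt_subtype hX]
    exact h a b

lemma mk_sons_preimage (hX : Dense X) {B : Set M} (hB : B ∈ nerv M)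
    (hpos : 0 < diam B) (hdiam : diam ((↑) ⁻¹' B : Set X) = diam B) :
    Cardinal.mk (sons X ((↑) ⁻¹' B)) = Cardinal.mk (sons M B) := by
  obtain ⟨c, -, hc⟩ := exists_eq_closedBall_diam hB
  have himage : sons X ((↑) ⁻¹' B) = (fun S : Set M => ((↑) ⁻¹' S : Set X)) '' sons M B := by
    ext T
    constructor
    · rintro ⟨⟨a, rfl⟩, hT⟩
      rw [hdiam] at hT ⊢
      have ha : (a : M) ∈ B := hT (mem_ball_self hpos)
      refine ⟨ball (a : M) (diam B), ⟨⟨a, rfl⟩, ?_⟩, rfl⟩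
      rw [hc] at ha
      have := IsUltrametricDist.closedBall_eq_of_mem ha
      exact ball_subset_closedBall.trans (this.symm.trans hc.symm).subset
    · rintro ⟨_, ⟨⟨a, rfl⟩, hS⟩, rfl⟩
      obtain ⟨a', ha', haa'⟩ := hX.exists_dist_lt a hpos
      refine ⟨⟨⟨a', ha'⟩, ?_⟩, Set.preimage_mono hS⟩
      rw [hdiam, IsUltrametricDist.ball_eq_of_mem (mem_ball'.mpr haa')]
      rfl
  rw [himage]
  refine Cardinal.mk_image_eq_of_injOn _ _ ?_
  rintro _ ⟨⟨a, rfl⟩, -⟩ _ ⟨⟨b, rfl⟩, -⟩ hab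
  obtain ⟨a', ha', haa'⟩ := hX.exists_dist_lt a hpos
  have hmem : (⟨a', ha'⟩ : X) ∈ ((↑) ⁻¹' ball a (diam B) : Set X) := mem_ball'.mpr haa'
  have hmem_ball_b : (⟨a', ha'⟩ : X) ∈ ((↑) ⁻¹' ball b (diam B) : Set X) := by
    simpa only [hab] using hmem
  rw [IsUltrametricDist.ball_eq_of_mem (show a' ∈ ball a _ from hmem),
    IsUltrametricDist.ball_eq_of_mem (show a' ∈ ball b _ from hmem_ball_b)]

/-- Closed balls of the nerve centred in a dense subset have traces in its nerve. -/
lemma trace_closedBall (hX : Dense X) {a : X} {r : ℝ} (hr : 0 < r) (h : r ∈ specAt M a) :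
    closedBall a r ∈ nerv X ∧ closedBall (a : M) r ∈ nerv M ∧
      diam (closedBall a r) = r ∧ diam (closedBall (a : M) r) = r ∧
      Cardinal.mk (sons X (closedBall a r)) = Cardinal.mk (sons M (closedBall (a : M) r)) := by
  have h' : r ∈ specAt X a := specAt_subtype hX a ▸ h
  have hd := diam_closedBall_of_mem_specAt h
  have hd' := diam_closedBall_of_mem_specAt h'
  have hB : closedBall (a : M) r ∈ nerv M := ⟨a, r, h, rfl⟩
  have hpre : closedBall a r = ((↑) ⁻¹' closedBall (a : M) r : Set X) := rfl
  refine ⟨⟨a, r, h', rfl⟩, hB, hd', hd, ?_⟩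
  rw [hpre] at hd' ⊢
  exact mk_sons_preimage hX hB (hr.trans_eq hd.symm) (hd'.trans hd.symm)

lemma exists_nerv_of_mem_nerv_subtype (hX : Dense X) {C : Set X} (hC : C ∈ nerv X)
    (hpos : 0 < diam C) :
    ∃ B ∈ nerv M, diam B = diam C ∧ Cardinal.mk (sons X C) = Cardinal.mk (sons M B) := by
  obtain ⟨a, ha, hCa⟩ := exists_eq_closedBall_diam hC
  rw [specAt_subtype hX] at ha
  obtain ⟨-, hB, -, hd, hmk⟩ := trace_closedBall hX hpos ha
  exact ⟨_, hB, hd, (congrArg (fun S => Cardinal.mk (sons X S)) hCa).trans hmk⟩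

lemma exists_nerv_subtype_of_mem_nerv (hX : Dense X) {B : Set M} (hB : B ∈ nerv M)
    (hpos : 0 < diam B) :
    ∃ C ∈ nerv X, diam C = diam B ∧ Cardinal.mk (sons X C) = Cardinal.mk (sons M B) := by
  obtain ⟨a, ha, hBa⟩ := exists_eq_closedBall_diam hB
  obtain ⟨a', ha', haa'⟩ := hX.exists_dist_lt a hpos
  obtain ⟨hC, -, hd, -, hmk⟩ :=
    trace_closedBall (a := ⟨a', ha'⟩) hX hpos (mem_specAt_of_dist_lt haa' ha)
  have hball : closedBall a' (diam B) = B := by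
    rw [← IsUltrametricDist.closedBall_eq_of_mem (mem_closedBall'.mpr haa'.le), ← hBa]
  refine ⟨_, hC, hd, hmk.trans ?_⟩
  simp only [hball]

lemma propH2_subtype_iff (hX : Dense X) : PropH2 X ↔ PropH2 M := by
  constructor
  · intro h B hB B' hB' hd
    rcases (diam_nonneg : 0 ≤ diam B).eq_or_lt with h0 | hpos
    · rw [mk_sons_of_diam_eq_zero hB h0.symm, mk_sons_of_diam_eq_zero hB' (hd ▸ h0.symm)]
    · obtain ⟨C, hC, hCd, hCB⟩ := exists_nerv_subtype_of_mem_nerv hX hB hpos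
      obtain ⟨C', hC', hCd', hCB'⟩ := exists_nerv_subtype_of_mem_nerv hX hB' (hd ▸ hpos)
      rw [← hCB, ← hCB']
      exact h C hC C' hC' (by rw [hCd, hCd', hd])
  · intro h C hC C' hC' hd
    rcases (diam_nonneg : 0 ≤ diam C).eq_or_lt with h0 | hpos
    · rw [mk_sons_of_diam_eq_zero hC h0.symm, mk_sons_of_diam_eq_zero hC' (hd ▸ h0.symm)]
    · obtain ⟨B, hB, hBd, hCB⟩ := exists_nerv_of_mem_nerv_subtype hX hC hpos
      obtain ⟨B', hB', hBd', hCB'⟩ := exists_nerv_of_mem_nerv_subtype hX hC' (hd ▸ hpos)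
      rw [hCB, hCB']
      exact h B hB B' hB' (by rw [hBd, hBd', hd])

lemma degSeq_subtype (hX : Dense X) {r : ℝ} (hr : 0 < r) : degSeq X r = degSeq M r := by
  unfold degSeq
  congr 1
  ext c
  constructor
  · rintro ⟨C, hC, rfl, rfl⟩
    obtain ⟨B, hB, hd, hmk⟩ := exists_nerv_of_mem_nerv_subtype hX hC hr
    exact ⟨B, hB, hd, hmk⟩
  · rintro ⟨B, hB, rfl, rfl⟩
    obtain ⟨C, hC, hd, hmk⟩ := exists_nerv_subtype_of_mem_nerv hX hB hr
    exact ⟨C, hC, hd, hmk.symm⟩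

end Ultrametric

/-- Let `M` be an ultrametric space and `X` a topologically dense subset
of `M`.  Then the subspace `M↾X` satisfies property `h1` (resp. `h2`) if and only if `M`
does; moreover, when property `h` holds, the two spaces have the same degree sequence on
the common spectrum minus `{0}`. -/
theorem stmt9 {M : Type*} [MetricSpace M]
    (ultra : ∀ x y z : M, dist x z ≤ max (dist x y) (dist y z))
    (X : Set M) (hX : Dense X) :
    (PropH1 X ↔ PropH1 M) ∧ (PropH2 X ↔ PropH2 M) ∧
      ((PropH1 M ∧ PropH2 M) → ∀ r ∈ specSet M \ {0}, degSeq X r = degSeq M r) := by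
  have : IsUltrametricDist M := ⟨ultra⟩
  refine ⟨propH1_subtype_iff hX, propH2_subtype_iff hX, ?_⟩
  rintro - _ ⟨⟨x, y, rfl⟩, hr⟩
  exact degSeq_subtype hX (lt_of_le_of_ne dist_nonneg (Ne.symm hr))
end

section
/- Every ultrametric space M embeds isometrically into a homogeneous ultrametric space with the same spectrum as M. -/
universe u

section Defs

variable (M : Type*) [MetricSpace M]

/-- A metric space is homogeneous if every isometry between two finite subsets of it
extends to a surjective isometry of the whole space onto itself. -/
def IsHomogeneous : Prop :=
  ∀ F : Set M, F.Finite → ∀ φ : M → M,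
    (∀ x ∈ F, ∀ y ∈ F, dist (φ x) (φ y) = dist x y) →
    ∃ ψ : M ≃ᵢ M, ∀ x ∈ F, ψ x = φ x

/-- `N` is a suitable target for `M`: it is an ultrametric homogeneous space with the
same spectrum as `M` into which `M` embeds isometrically. -/
def IsHomogeneousExtension (N : Type u) [MetricSpace N] : Prop :=
  (∀ x y z : N, dist x z ≤ max (dist x y) (dist y z)) ∧
    IsHomogeneous N ∧ (∃ f : M → N, Isometry f) ∧ specSet N = specSet M

end Defs

section Homogeneity

variable {N : Type*} [MetricSpace N]

/-- In an ultrametric space, a point of an open ball can replace the center when measuring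
distances to points outside of the ball. -/
theorem dist_eq_of_dist_lt_of_le (ultra : ∀ x y z : N, dist x z ≤ max (dist x y) (dist y z))
    {s : ℝ} {p z w : N} (hz : dist z p < s) (hw : s ≤ dist w p) : dist z w = dist p w := by
  have h₁ := ultra z p w
  have h₂ := ultra p z w
  rw [dist_comm w p] at hw
  rw [dist_comm p z] at h₂
  grind

/-- In an ultrametric space, an involutive isometry exchanging `p` and `q` can be modified to fix
every point that is equidistant from `p` and `q`. -/
theorem exists_isometryEquiv_fixing (ultra : ∀ x y z : N, dist x z ≤ max (dist x y) (dist y z))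
    {T : N → N} (hT : Isometry T) (hT' : Function.Involutive T) {p q : N} (hpq : T p = q) :
    ∃ σ : N ≃ᵢ N, σ p = q ∧ ∀ e, dist p e = dist q e → σ e = e := by
  classical
  have hqp : T q = p := by rw [← hpq, hT' p]
  have hTp (z : N) : dist (T z) p = dist z q := by rw [← hqp, hT.dist_eq]
  have hTq (z : N) : dist (T z) q = dist z p := by rw [← hpq, hT.dist_eq]
  let σ : N → N := fun z ↦ if dist z p < dist p q ∨ dist z q < dist p q then T z else z
  have σ_pos {z : N} (h : dist z p < dist p q ∨ dist z q < dist p q) : σ z = T z := if_pos h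
  have σ_neg {z : N} (h : ¬(dist z p < dist p q ∨ dist z q < dist p q)) : σ z = z := if_neg h
  have σ_invol : Function.Involutive σ := by
    intro z
    by_cases h : dist z p < dist p q ∨ dist z q < dist p q
    · rw [σ_pos h, σ_pos (by rwa [hTp, hTq, or_comm]), hT' z]
    · rw [σ_neg h, σ_neg h]
  have mixed {z w : N} (hz : dist z p < dist p q ∨ dist z q < dist p q)
      (hw : ¬(dist w p < dist p q ∨ dist w q < dist p q)) : dist (T z) w = dist z w := by
    push Not at hw
    have hwpq : dist p w = dist q w := by
      have h₁ := ultra p q w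
      have h₂ := ultra q p w
      rw [dist_comm w p, dist_comm w q] at hw
      rw [dist_comm q p] at h₂
      grind
    rcases hz with hz | hz
    · rw [dist_eq_of_dist_lt_of_le ultra hz hw.1,
        dist_eq_of_dist_lt_of_le ultra (by rwa [hTq]) hw.2, hwpq]
    · rw [dist_eq_of_dist_lt_of_le ultra hz hw.2,
        dist_eq_of_dist_lt_of_le ultra (by rwa [hTp]) hw.1, hwpq]
  have σ_isom : Isometry σ := by
    refine Isometry.of_dist_eq fun z w ↦ ?_
    by_cases hz : dist z p < dist p q ∨ dist z q < dist p q <;>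
      by_cases hw : dist w p < dist p q ∨ dist w q < dist p q
    · rw [σ_pos hz, σ_pos hw, hT.dist_eq]
    · rw [σ_pos hz, σ_neg hw, mixed hz hw]
    · rw [σ_neg hz, σ_pos hw, dist_comm, mixed hw hz, dist_comm]
    · rw [σ_neg hz, σ_neg hw]
  refine ⟨⟨σ_invol.toPerm, σ_isom⟩, ?_, fun e he ↦ σ_neg ?_⟩
  · change σ p = q
    by_cases h : p = q
    · subst h
      exact σ_neg (by simp)
    · rw [σ_pos (Or.inl (by simpa using h)), hpq]
  · have h := ultra p e q
    rw [dist_comm e q, ← he, max_self] at h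
    rw [dist_comm e p, dist_comm e q, ← he, or_self]
    exact not_lt.mpr h

/-- An ultrametric space in which any two points are exchanged by an involutive isometry is
homogeneous. -/
theorem isHomogeneous_of_involutive (ultra : ∀ x y z : N, dist x z ≤ max (dist x y) (dist y z))
    (hN : ∀ p q : N, ∃ T : N → N, Isometry T ∧ Function.Involutive T ∧ T p = q) :
    IsHomogeneous N := by
  intro F hF φ
  induction F, hF using Set.Finite.induction_on with
  | empty => exact fun _ ↦ ⟨IsometryEquiv.refl N, by simp⟩
  | @insert a F _ _ ih =>
    intro hφ
    obtain ⟨ψ, hψ⟩ := ih fun x hx y hy ↦ hφ x (Or.inr hx) y (Or.inr hy)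
    obtain ⟨T, hT, hT', hTa⟩ := hN (ψ a) (φ a)
    obtain ⟨σ, hσa, hσ⟩ := exists_isometryEquiv_fixing ultra hT hT' hTa
    refine ⟨ψ.trans σ, ?_⟩
    rintro x (rfl | hx)
    · exact hσa
    · change σ (ψ x) = φ x
      rw [hψ x hx]
      apply hσ
      rw [hφ a (Or.inl rfl) x (Or.inr hx), ← hψ x hx, ψ.isometry.dist_eq]

end Homogeneity

section BallChains

open Metric

variable {M : Type*} [MetricSpace M]

/-- Whether `Finsupp.mapDomain` kills `A` depends only on how the map identifies the points of the
support of `A`. -/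
theorem Finsupp.mapDomain_eq_zero_of_factors {α β γ R : Type*} [AddCommMonoid R] {A : α →₀ R}
    {f : α → β} {g : α → γ} (hfg : ∀ a ∈ A.support, ∀ b ∈ A.support, f a = f b → g a = g b)
    (hA : A.mapDomain f = 0) : A.mapDomain g = 0 := by
  classical
  rcases isEmpty_or_nonempty α with hα | ⟨⟨a₀⟩⟩
  · rw [Subsingleton.elim A 0, Finsupp.mapDomain_zero]
  let h : β → γ := fun q ↦ if hq : ∃ a ∈ A.support, f a = q then g hq.choose else g a₀
  have hh : A.mapDomain g = A.mapDomain (h ∘ f) := by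
    refine Finsupp.mapDomain_congr fun a ha ↦ ?_
    have hq : ∃ b ∈ A.support, f b = f a := ⟨a, ha, rfl⟩
    simp only [Function.comp_apply, h, dif_pos hq]
    exact (hfg _ hq.choose_spec.1 a ha hq.choose_spec.2).symm
  rw [hh, Finsupp.mapDomain_comp, hA, Finsupp.mapDomain_zero]

/-- `A` is balanced at scale `r` if its total weight on each closed ball of radius `r` is zero. -/
def IsBalanced (r : ℝ) (A : M →₀ ℤ) : Prop :=
  A.mapDomain (fun x ↦ closedBall x r) = 0

theorem closedBall_eq_iff_dist_le (ultra : ∀ x y z : M, dist x z ≤ max (dist x y) (dist y z))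
    {r : ℝ} (hr : 0 ≤ r) {x y : M} : closedBall x r = closedBall y r ↔ dist x y ≤ r := by
  refine ⟨fun h ↦ mem_closedBall.mp (h ▸ mem_closedBall_self hr), fun h ↦ ?_⟩
  ext z
  simp only [mem_closedBall]
  exact ⟨fun hz ↦ (ultra z x y).trans (max_le hz h),
    fun hz ↦ (ultra z y x).trans (max_le hz (dist_comm x y ▸ h))⟩

theorem IsBalanced.of_dist_le (ultra : ∀ x y z : M, dist x z ≤ max (dist x y) (dist y z))
    {r s : ℝ} (hr : 0 ≤ r) (hs : 0 ≤ s) {A : M →₀ ℤ} (hA : IsBalanced r A)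
    (h : ∀ a ∈ A.support, ∀ b ∈ A.support, dist a b ≤ r → dist a b ≤ s) : IsBalanced s A := by
  refine Finsupp.mapDomain_eq_zero_of_factors (fun a ha b hb hab ↦ ?_) hA
  rw [closedBall_eq_iff_dist_le ultra hr] at hab
  exact (closedBall_eq_iff_dist_le ultra hs).mpr (h a ha b hb hab)

theorem IsBalanced.mono (ultra : ∀ x y z : M, dist x z ≤ max (dist x y) (dist y z))
    {r s : ℝ} (hr : 0 ≤ r) (hrs : r ≤ s) {A : M →₀ ℤ} (hA : IsBalanced r A) : IsBalanced s A :=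
  hA.of_dist_le ultra hr (hr.trans hrs) fun _ _ _ _ h ↦ h.trans hrs

theorem IsBalanced.add {r : ℝ} {A B : M →₀ ℤ} (hA : IsBalanced r A) (hB : IsBalanced r B) :
    IsBalanced r (A + B) := by
  rw [IsBalanced, Finsupp.mapDomain_add, hA, hB, add_zero]

theorem IsBalanced.neg {r : ℝ} {A : M →₀ ℤ} (hA : IsBalanced r A) : IsBalanced r (-A) := by
  have h := Finsupp.mapDomain_add (f := fun x : M ↦ closedBall x r) (v₁ := A) (v₂ := -A)
  rw [add_neg_cancel, Finsupp.mapDomain_zero, hA, zero_add] at h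
  exact h.symm

theorem isBalanced_zero (r : ℝ) : IsBalanced r (0 : M →₀ ℤ) :=
  Finsupp.mapDomain_zero

theorem isBalanced_zero_iff {A : M →₀ ℤ} : IsBalanced 0 A ↔ A = 0 := by
  refine ⟨fun h ↦ ?_, fun h ↦ h ▸ isBalanced_zero 0⟩
  refine Finsupp.mapDomain_injective (f := fun x : M ↦ closedBall x 0) (fun x y hxy ↦ ?_)
    (h.trans Finsupp.mapDomain_zero.symm)
  simpa using hxy

theorem isBalanced_single_sub_single_iff
    (ultra : ∀ x y z : M, dist x z ≤ max (dist x y) (dist y z)) {r : ℝ} (hr : 0 ≤ r) {x y : M} :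
    IsBalanced r (Finsupp.single x 1 - Finsupp.single y 1) ↔ dist x y ≤ r := by
  rw [IsBalanced, sub_eq_add_neg, ← Finsupp.single_neg, Finsupp.mapDomain_add,
    Finsupp.mapDomain_single, Finsupp.mapDomain_single, Finsupp.single_neg, ← sub_eq_add_neg,
    sub_eq_zero, Finsupp.single_left_inj one_ne_zero, closedBall_eq_iff_dist_le ultra hr]

/-- The scales at which a chain is balanced have a least element, which is a distance in `M`. -/
theorem exists_isLeast_isBalanced [Nonempty M]
    (ultra : ∀ x y z : M, dist x z ≤ max (dist x y) (dist y z)) {A : M →₀ ℤ}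
    (hA : ∃ r, 0 ≤ r ∧ IsBalanced r A) :
    ∃ r ∈ specSet M, IsLeast {r | 0 ≤ r ∧ IsBalanced r A} r := by
  classical
  let D : Finset ℝ := insert 0 ((A.support ×ˢ A.support).image fun p ↦ dist p.1 p.2)
  have D_spec {d : ℝ} (hd : d ∈ D) : d ∈ specSet M := by
    rcases Finset.mem_insert.mp hd with rfl | hd
    · exact ⟨Classical.arbitrary M, _, dist_self _⟩
    · obtain ⟨p, -, rfl⟩ := Finset.mem_image.mp hd
      exact ⟨p.1, p.2, rfl⟩
  have D_nonneg {d : ℝ} (hd : d ∈ D) : 0 ≤ d := by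
    obtain ⟨x, y, rfl⟩ := D_spec hd
    exact dist_nonneg
  have round {r : ℝ} (hr : 0 ≤ r) (hAr : IsBalanced r A) : ∃ d ∈ D, IsBalanced d A ∧ d ≤ r := by
    obtain ⟨d, hd, hmax⟩ := (D.filter (· ≤ r)).exists_max_image id
      ⟨0, Finset.mem_filter.mpr ⟨Finset.mem_insert_self _ _, hr⟩⟩
    rw [Finset.mem_filter] at hd
    refine ⟨d, hd.1, hAr.of_dist_le ultra hr (D_nonneg hd.1) fun a ha b hb hab ↦ ?_, hd.2⟩
    exact hmax _ (Finset.mem_filter.mpr ⟨Finset.mem_insert_of_mem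
      (Finset.mem_image.mpr ⟨(a, b), Finset.mk_mem_product ha hb, rfl⟩), hab⟩)
  obtain ⟨r, hr, hAr⟩ := hA
  obtain ⟨d, hd, hAd, -⟩ := round hr hAr
  obtain ⟨m, hm, hmin⟩ := (D.filter (IsBalanced · A)).exists_min_image id
    ⟨d, Finset.mem_filter.mpr ⟨hd, hAd⟩⟩
  rw [Finset.mem_filter] at hm
  refine ⟨m, D_spec hm.1, ⟨D_nonneg hm.1, hm.2⟩, fun s hs ↦ ?_⟩
  obtain ⟨e, he, hAe, hes⟩ := round hs.1 hs.2
  exact (hmin e (Finset.mem_filter.mpr ⟨he, hAe⟩)).trans hes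

/-- The group of integral chains on `M` that are balanced at some scale. -/
def balancedChains (ultra : ∀ x y z : M, dist x z ≤ max (dist x y) (dist y z)) :
    AddSubgroup (M →₀ ℤ) where
  carrier := {A | ∃ r, 0 ≤ r ∧ IsBalanced r A}
  zero_mem' := ⟨0, le_rfl, isBalanced_zero 0⟩
  add_mem' := by
    rintro A B ⟨r, hr, hA⟩ ⟨s, hs, hB⟩
    exact ⟨max r s, hr.trans (le_max_left r s),
      (hA.mono ultra hr (le_max_left r s)).add (hB.mono ultra hs (le_max_right r s))⟩
  neg_mem' := by
    rintro A ⟨r, hr, hA⟩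
    exact ⟨r, hr, hA.neg⟩

/-- The least scale at which a chain is balanced. -/
noncomputable def balanceScale (A : M →₀ ℤ) : ℝ :=
  sInf {r | 0 ≤ r ∧ IsBalanced r A}

theorem balanceScale_neg (A : M →₀ ℤ) : balanceScale (-A) = balanceScale A := by
  unfold balanceScale
  congr 1
  ext r
  exact and_congr_right fun _ ↦ ⟨fun h ↦ neg_neg A ▸ h.neg, fun h ↦ h.neg⟩

variable [Nonempty M] (ultra : ∀ x y z : M, dist x z ≤ max (dist x y) (dist y z))

theorem isLeast_balanceScale (A : balancedChains ultra) :
    IsLeast {r | 0 ≤ r ∧ IsBalanced r (A : M →₀ ℤ)} (balanceScale (A : M →₀ ℤ)) := by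
  obtain ⟨r, -, hr⟩ := exists_isLeast_isBalanced ultra A.2
  rwa [balanceScale, hr.csInf_eq]

theorem balanceScale_mem_specSet (A : balancedChains ultra) :
    balanceScale (A : M →₀ ℤ) ∈ specSet M := by
  obtain ⟨r, hr, hr'⟩ := exists_isLeast_isBalanced ultra A.2
  rwa [balanceScale, hr'.csInf_eq]

theorem balanceScale_add_le (A B : balancedChains ultra) :
    balanceScale ((A + B : balancedChains ultra) : M →₀ ℤ) ≤
      max (balanceScale (A : M →₀ ℤ)) (balanceScale (B : M →₀ ℤ)) := by
  obtain ⟨⟨hA, hA'⟩, -⟩ := isLeast_balanceScale ultra A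
  obtain ⟨⟨hB, hB'⟩, -⟩ := isLeast_balanceScale ultra B
  exact (isLeast_balanceScale ultra (A + B)).2 ⟨hA.trans (le_max_left _ _),
    (hA'.mono ultra hA (le_max_left _ _)).add (hB'.mono ultra hB (le_max_right _ _))⟩

theorem balanceScale_sub_le (A B C : balancedChains ultra) :
    balanceScale ((A - C : balancedChains ultra) : M →₀ ℤ) ≤
      max (balanceScale ((A - B : balancedChains ultra) : M →₀ ℤ))
        (balanceScale ((B - C : balancedChains ultra) : M →₀ ℤ)) := by
  rw [← sub_add_sub_cancel A B C]
  exact balanceScale_add_le ultra _ _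

/-- The translation-invariant ultrametric on balanced chains. -/
noncomputable abbrev balancedChainsMetricSpace : MetricSpace (balancedChains ultra) where
  dist A B := balanceScale ((A - B : balancedChains ultra) : M →₀ ℤ)
  dist_self A := by
    rw [sub_self]
    exact le_antisymm ((isLeast_balanceScale ultra 0).2 ⟨le_rfl, isBalanced_zero 0⟩)
      (isLeast_balanceScale ultra 0).1.1
  dist_comm A B := by
    rw [← neg_sub B A, AddSubgroup.coe_neg, balanceScale_neg]
  dist_triangle A B C := (balanceScale_sub_le ultra A B C).trans
    (max_le_add_of_nonneg (isLeast_balanceScale ultra _).1.1 (isLeast_balanceScale ultra _).1.1)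
  eq_of_dist_eq_zero {A B} h := by
    have hAB := (isLeast_balanceScale ultra (A - B)).1.2
    rw [h, isBalanced_zero_iff] at hAB
    exact sub_eq_zero.mp (Subtype.ext hAB)

theorem isHomogeneousExtension_balancedChains :
    @IsHomogeneousExtension M _ (balancedChains ultra) (balancedChainsMetricSpace ultra) := by
  let := balancedChainsMetricSpace ultra
  have dist_def (A B : balancedChains ultra) :
      dist A B = balanceScale ((A - B : balancedChains ultra) : M →₀ ℤ) := rfl
  have embedding : ∃ f : M → balancedChains ultra, Isometry f := by
    let x₀ : M := Classical.arbitrary M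
    refine ⟨fun x ↦ ⟨Finsupp.single x 1 - Finsupp.single x₀ 1, dist x x₀, dist_nonneg,
      (isBalanced_single_sub_single_iff ultra dist_nonneg).mpr le_rfl⟩,
      Isometry.of_dist_eq fun x y ↦ ?_⟩
    rw [dist_def, AddSubgroup.coe_sub, sub_sub_sub_cancel_right]
    refine IsLeast.csInf_eq ⟨⟨dist_nonneg,
      (isBalanced_single_sub_single_iff ultra dist_nonneg).mpr le_rfl⟩, fun r hr ↦ ?_⟩
    exact (isBalanced_single_sub_single_iff ultra hr.1).mp hr.2
  refine ⟨balanceScale_sub_le ultra,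
    isHomogeneous_of_involutive (balanceScale_sub_le ultra) fun A B ↦ ?_, embedding, ?_⟩
  · refine ⟨fun C ↦ A + B - C, Isometry.of_dist_eq fun C D ↦ ?_, fun C ↦ sub_sub_cancel _ C,
      add_sub_cancel_left A B⟩
    rw [dist_comm C D, dist_def, dist_def, sub_sub_sub_cancel_left]
  · refine Set.Subset.antisymm ?_ ?_
    · rintro _ ⟨A, B, rfl⟩
      exact balanceScale_mem_specSet ultra (A - B)
    · rintro _ ⟨x, y, rfl⟩
      obtain ⟨f, hf⟩ := embedding
      exact ⟨f x, f y, hf.dist_eq x y⟩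

end BallChains

/-- Being a homogeneous extension depends only on the isometry class of the extended space. -/
theorem IsHomogeneousExtension.of_isometryEquiv {M M' : Type*} [MetricSpace M] [MetricSpace M']
    {N : Type u} [MetricSpace N] (e : M ≃ᵢ M') (h : IsHomogeneousExtension M' N) :
    IsHomogeneousExtension M N := by
  obtain ⟨hultra, hhom, ⟨f, hf⟩, hspec⟩ := h
  refine ⟨hultra, hhom, ⟨f ∘ e, hf.comp e.isometry⟩, hspec.trans (Set.ext fun r ↦ ?_)⟩
  constructor
  · rintro ⟨x, y, rfl⟩
    exact ⟨e.symm x, e.symm y, e.symm.isometry.dist_eq x y⟩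
  · rintro ⟨x, y, rfl⟩
    exact ⟨e x, e y, e.isometry.dist_eq x y⟩

/-- Every ultrametric space `M` embeds isometrically into a homogeneous
ultrametric space with the same spectrum as `M`. -/
theorem stmt11 {M : Type u} [MetricSpace M]
    (ultra : ∀ x y z : M, dist x z ≤ max (dist x y) (dist y z)) :
    ∃ (N : Type (u + 1)) (mN : MetricSpace N), @IsHomogeneousExtension M _ N mN := by
  let e : M ≃ᵢ ULift.{u + 1} M := ⟨Equiv.ulift.symm, fun _ _ ↦ rfl⟩
  rcases isEmpty_or_nonempty M with hM | hM
  · refine ⟨ULift.{u + 1} M, inferInstance, IsHomogeneousExtension.of_isometryEquiv e ?_⟩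
    exact ⟨isEmptyElim, fun _ _ _ _ ↦ ⟨IsometryEquiv.refl _, isEmptyElim⟩,
      ⟨id, isometry_id⟩, rfl⟩
  · have ultra' (x y z : ULift.{u + 1} M) : dist x z ≤ max (dist x y) (dist y z) :=
      ultra x.down y.down z.down
    let := balancedChainsMetricSpace ultra'
    exact ⟨balancedChains ultra', inferInstance,
      (isHomogeneousExtension_balancedChains ultra').of_isometryEquiv e⟩
end

section
/- Let κ be an infinite cardinal and V ⊆ ℝ⁺ with 0 ∈ V. Every ultrametric space M with Spec(M) ⊆ V and density at most κ is isometrically embeddable into M_κ(Well(V)), the space M_s(Well(V)) for the constant function s(r) = κ. -/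
universe u

open Cardinal

/-- A point of the space `M_s(J)`: a function `f` defined on `V* = V \ {0}` such that
`f r` is an element of the cardinal `s r` (viewed as an initial ordinal), whose support
`{r ∈ V* | f r ≠ 0}` belongs to the collection `J`.  (The function is extended by `0`
outside `V*`.) -/
structure MsPoint (V : Set ℝ) (s : ℝ → Cardinal.{u}) (J : Set (Set ℝ)) :
    Type (u + 1) where
  toFun : ℝ → Ordinal.{u}
  lt_ord : ∀ r ∈ V \ {0}, toFun r < (s r).ord
  eq_zero : ∀ r ∉ V \ {0}, toFun r = 0
  supp_mem : {r | r ∈ V \ {0} ∧ toFun r ≠ 0} ∈ J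

/-- The ultrametric distance on `M_s(J)`:
`d(f, g) = sup {r ∈ V* | f r ≠ g r}` (with `sup ∅ = 0`). -/
noncomputable def msDist {V : Set ℝ} {s : ℝ → Cardinal.{u}} {J : Set (Set ℝ)}
    (f g : MsPoint V s J) : ℝ :=
  sSup {r | r ∈ V \ {0} ∧ f.toFun r ≠ g.toFun r}

/-- `Bound(V)`: the subsets of `V* = V \ {0}` which are bounded above in `ℝ`. -/
def BoundSets (V : Set ℝ) : Set (Set ℝ) := {A | A ⊆ V \ {0} ∧ BddAbove A}

/-- `Fin(V)`: the finite subsets of `V* = V \ {0}`. -/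
def FinSets (V : Set ℝ) : Set (Set ℝ) := {A | A ⊆ V \ {0} ∧ A.Finite}

/-- `Well(V)`: the subsets of `V* = V \ {0}` which are well-ordered under `≥`
(equivalently, on which `>` is well-founded). -/
def WellSets (V : Set ℝ) : Set (Set ℝ) :=
  {A | A ⊆ V \ {0} ∧ A.WellFoundedOn (· > · : ℝ → ℝ → Prop)}

variable (M : Type u) [MetricSpace M]

/-- There is a choice function on nonempty sets, namely the minimum for a well-order, which
strictly decreases whenever it changes on passing to a larger set. -/
theorem exists_wellFounded_choice (α : Type*) [Nonempty α] :
    ∃ (r : α → α → Prop) (m : Set α → α), WellFounded r ∧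
      (∀ S : Set α, S.Nonempty → m S ∈ S) ∧
      ∀ S T : Set α, S ⊆ T → S.Nonempty → m S ≠ m T → r (m T) (m S) := by
  classical
  obtain ⟨_, hwf⟩ := exists_wellFoundedLT α
  have wf : WellFounded ((· < ·) : α → α → Prop) := wellFounded_lt
  refine ⟨(· < ·), fun S => if h : S.Nonempty then wf.min S h else Classical.arbitrary α, wf,
    fun S hS => ?_, fun S T hST hS hne => ?_⟩
  · simpa [hS] using wf.min_mem S hS
  · have hT := hS.mono hST
    simp only [hS, hT, dif_pos] at hne ⊢
    exact lt_of_le_of_ne (wf.min_le (hST (wf.min_mem S hS))) (Ne.symm hne)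

/-- A type of cardinality at most an infinite `κ` injects into the nonzero ordinals below
`κ.ord`. -/
theorem exists_injective_ordinal_ne_zero {α : Type u} {κ : Cardinal.{u}} (hκ : ℵ₀ ≤ κ)
    (hα : #α ≤ κ) :
    ∃ g : α → Ordinal.{u}, Function.Injective g ∧ ∀ a, g a ≠ 0 ∧ g a < κ.ord := by
  rw [← Cardinal.mk_ord_toType κ] at hα
  obtain ⟨e⟩ := hα
  refine ⟨fun a => Order.succ (Ordinal.ToType.mk.symm (e a) : Ordinal),
    fun a b hab => ?_, fun a => ⟨?_, ?_⟩⟩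
  · exact e.injective (Ordinal.ToType.mk.symm.injective (Subtype.ext (Order.succ_injective hab)))
  · exact Order.succ_ne_bot _
  · exact (Cardinal.isSuccLimit_ord hκ).succ_lt (Ordinal.ToType.mk.symm (e a)).2

/-- Let `κ` be an infinite cardinal and `V ⊆ ℝ⁺` with `0 ∈ V`.  Every
ultrametric space `M` with `Spec(M) ⊆ V` and density at most `κ` is isometrically
embeddable into `M_κ(Well(V))`, the space `M_s(Well(V))` for the constant function
`s r = κ`. -/
theorem stmt14 (κ : Cardinal.{u}) (hκ : Cardinal.aleph0 ≤ κ)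
    (V : Set ℝ) (hV : V ⊆ {r : ℝ | 0 ≤ r}) (h0V : (0 : ℝ) ∈ V)
    (ultra : ∀ x y z : M, dist x z ≤ max (dist x y) (dist y z))
    (hspec : specSet M ⊆ V)
    (hdens : ∃ D : Set M, Dense D ∧ Cardinal.mk D ≤ κ) :
    ∃ f : M → MsPoint V (fun _ => κ) (WellSets V),
      ∀ x y : M, msDist (f x) (f y) = dist x y := by
  classical
  obtain ⟨D, hD, hDκ⟩ := hdens
  obtain ⟨g, hg, hg'⟩ := exists_injective_ordinal_ne_zero hκ hDκ
  rcases isEmpty_or_nonempty M with hM | hM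
  · exact ⟨fun x => hM.elim x, fun x => hM.elim x⟩
  have : IsUltrametricDist M := ⟨ultra⟩
  have : Nonempty D := hD.nonempty.to_subtype
  obtain ⟨rel, m, wf, hm, hmono⟩ := exists_wellFounded_choice M
  have hp : ∀ S : Set M, ∃ d : D, IsOpen S → S.Nonempty → (d : M) ∈ S := by
    intro S
    by_cases h : IsOpen S ∧ S.Nonempty
    · obtain ⟨y, hyS, hyD⟩ := hD.inter_open_nonempty S h.1 h.2
      exact ⟨⟨y, hyD⟩, fun _ _ => hyS⟩
    · exact ⟨Classical.arbitrary D, fun h₁ h₂ => absurd ⟨h₁, h₂⟩ h⟩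
  choose p hp using hp
  have hpos : ∀ r ∈ V \ {0}, 0 < r := fun r hr => lt_of_le_of_ne (hV hr.1) (Ne.symm hr.2)
  -- `F x r` labels the open ball `B(x, r)` among the open balls of radius `r` inside the
  -- closed ball of radius `r`; the label is `0` when it holds the designated point.
  let F : M → ℝ → Ordinal.{u} := fun x r =>
    if r ∈ V \ {0} ∧ ¬ dist (m (Metric.closedBall x r)) x < r then g (p (Metric.ball x r)) else 0
  have hF_eq : ∀ x y r, dist x y < r → F x r = F y r := by
    intro x y r hxy
    have hb : Metric.ball x r = Metric.ball y r := IsUltrametricDist.ball_eq_of_mem (Metric.mem_ball'.2 hxy)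
    have hc : Metric.closedBall x r = Metric.closedBall y r :=
      IsUltrametricDist.closedBall_eq_of_mem (Metric.mem_closedBall'.2 hxy.le)
    have hmem : dist (m (Metric.closedBall y r)) x < r ↔
        dist (m (Metric.closedBall y r)) y < r := by
      rw [← Metric.mem_ball, hb, Metric.mem_ball]
    simp only [F, hb, hc, hmem]
  have hF_ne : ∀ x y, x ≠ y → F x (dist x y) ≠ F y (dist x y) := by
    intro x y hxy h
    have hr : dist x y ∈ V \ {0} := ⟨hspec ⟨x, y, rfl⟩, dist_ne_zero.2 hxy⟩
    have hc : Metric.closedBall x (dist x y) = Metric.closedBall y (dist x y) :=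
      IsUltrametricDist.closedBall_eq_of_mem (Metric.mem_closedBall'.2 le_rfl)
    have hsep : ∀ z, dist z x < dist x y → ¬ dist z y < dist x y := by
      intro z h₁ h₂
      have := ultra x z y
      rw [dist_comm x z] at this
      exact absurd (this.trans_lt (max_lt h₁ h₂)) (lt_irrefl _)
    simp only [F, hr, hc, true_and] at h
    split_ifs at h with h₁ h₂ h₂
    · exact hsep _ h₁ h₂
    · exact (hg' _).1 h.symm
    · exact (hg' _).1 h
    · have hlt := hpos _ hr
      have hx := hp _ Metric.isOpen_ball ⟨x, Metric.mem_ball_self hlt⟩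
      have hy := hp _ Metric.isOpen_ball ⟨y, Metric.mem_ball_self hlt⟩
      rw [← hg h] at hy
      exact hsep _ hx hy
  have hF_lt : ∀ x r, F x r < κ.ord := by
    intro x r
    simp only [F]
    split_ifs
    · exact (hg' _).2
    · exact zero_le.trans_lt (hg' (Classical.arbitrary D)).2
  have hF_wf : ∀ x, {r | r ∈ V \ {0} ∧ F x r ≠ 0} ∈ WellSets V := by
    intro x
    refine ⟨fun r hr => hr.1, ?_⟩
    have hne : ∀ r ∈ V \ {0}, (Metric.closedBall x r).Nonempty := fun r hr =>
      ⟨x, Metric.mem_closedBall_self (hpos r hr).le⟩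
    have hdist : ∀ r, r ∈ V \ {0} ∧ F x r ≠ 0 → dist (m (Metric.closedBall x r)) x = r := by
      rintro r ⟨hr, hFr⟩
      refine le_antisymm (hm _ (hne r hr)) (not_lt.1 fun hlt => hFr ?_)
      simp only [F, hlt, not_true_eq_false, and_false, if_false]
    refine Subrelation.wf ?_
      (InvImage.wf (fun r : {r | r ∈ V \ {0} ∧ F x r ≠ 0} => m (Metric.closedBall x r)) wf)
    rintro ⟨a, ha⟩ ⟨b, hb⟩ (hab : b < a)
    refine hmono _ _ (Metric.closedBall_subset_closedBall hab.le) (hne b hb.1) fun h => ?_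
    have h' := hdist b hb
    rw [h, hdist a ha] at h'
    exact hab.ne' h'
  refine ⟨fun x => ⟨F x, fun r _ => hF_lt x r, fun r hr => if_neg fun h => hr h.1, hF_wf x⟩,
    fun x y => ?_⟩
  rcases eq_or_ne x y with rfl | hxy
  · simp [msDist]
  · refine IsGreatest.csSup_eq ⟨⟨⟨hspec ⟨x, y, rfl⟩, dist_ne_zero.2 hxy⟩, hF_ne x y hxy⟩, ?_⟩
    rintro r ⟨-, hr⟩
    exact not_lt.1 fun hlt => hr (hF_eq x y r hlt)
end
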